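/- Let d ≥ 1. Let c : Fin n → (d-dimensional little cubes) be a configuration with pairwise disjoint interiors and let O ⊆ Fin n be a set of indices such that (c j)(F_1) ⊆ F_1 for all j ∈ O; let c' : Fin m → (d-dimensional little cubes) be a configuration with pairwise disjoint interiors and let O' ⊆ Fin m be such that (c' k)(F_1) ⊆ F_1 for all k ∈ O'. Then for every i ∈ O, the operadic composite configuration c ∘_i c' (replacing c i by the cubes (c i) ∘ (c' 1), …, (c i) ∘ (c' m)) has pairwise disjoint interiors, each cube c j with j ∈ O, j ≠ i, still maps F_1 into F_1, and ((c i) ∘ (c' k))(F_1) ⊆ F_1 for every k ∈ O'. (This is the well-definedness of the operadic composition of the Swiss-Cheese operad SC_d at an open-coloured input.) -/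

import Mathlib

/-- The closed unit cube `K_d ⊆ ℝ^d`. -/
def unitCube (d : ℕ) : Set (Fin d → ℝ) := {t | ∀ i, 0 ≤ t i ∧ t i ≤ 1}

/-- A `d`-dimensional little cube. -/
def IsLittleCube (d : ℕ) (c : (Fin d → ℝ) → (Fin d → ℝ)) : Prop :=
  ∃ a b : Fin d → ℝ, (∀ i, 0 < b i) ∧ (∀ t i, c t i = a i + b i * t i) ∧
    ∀ t ∈ unitCube d, c t ∈ unitCube d

/-- The image of a little cube. -/
def Im {d : ℕ} (c : (Fin d → ℝ) → (Fin d → ℝ)) : Set (Fin d → ℝ) :=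
  c '' unitCube d

/-- The face `F_1 = {t ∈ K_d | t 0 = 1}` of the unit cube. -/
def face1 {d : ℕ} (hd : 0 < d) : Set (Fin d → ℝ) :=
  {t | t ∈ unitCube d ∧ t ⟨0, hd⟩ = 1}

/-- A little cube is a homeomorphism of the ambient space. -/
theorem IsLittleCube.exists_homeomorph {d : ℕ} {c : (Fin d → ℝ) → (Fin d → ℝ)}
    (hc : IsLittleCube d c) : ∃ e : (Fin d → ℝ) ≃ₜ (Fin d → ℝ), ⇑e = c := by
  obtain ⟨a, b, hb, h, -⟩ := hc
  refine ⟨Homeomorph.piCongrRight fun i =>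
    (Homeomorph.mulLeft₀ (b i) (hb i).ne').trans (Homeomorph.addLeft (a i)), ?_⟩
  ext t i
  simp [h]

theorem IsLittleCube.interior_Im_comp {d : ℕ} {f : (Fin d → ℝ) → (Fin d → ℝ)}
    (hf : IsLittleCube d f) (g : (Fin d → ℝ) → (Fin d → ℝ)) :
    interior (Im (f ∘ g)) = f '' interior (Im g) := by
  obtain ⟨e, rfl⟩ := hf.exists_homeomorph
  rw [e.image_interior, Im, Set.image_comp, Im]

theorem IsLittleCube.injective {d : ℕ} {c : (Fin d → ℝ) → (Fin d → ℝ)}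
    (hc : IsLittleCube d c) : Function.Injective c := by
  obtain ⟨e, rfl⟩ := hc.exists_homeomorph
  exact e.injective

theorem IsLittleCube.Im_subset {d : ℕ} {c : (Fin d → ℝ) → (Fin d → ℝ)}
    (hc : IsLittleCube d c) : Im c ⊆ unitCube d := by
  obtain ⟨a, b, -, -, h⟩ := hc
  exact Set.image_subset_iff.2 h

theorem IsLittleCube.Im_comp_subset {d : ℕ} (f : (Fin d → ℝ) → (Fin d → ℝ))
    {g : (Fin d → ℝ) → (Fin d → ℝ)} (hg : IsLittleCube d g) : Im (f ∘ g) ⊆ Im f := by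
  rw [Im, Set.image_comp]
  exact Set.image_mono hg.Im_subset

/-- well-definedness of the Swiss-Cheese operadic composition at
an open-coloured input. -/
theorem swissCheese_comp {d n m : ℕ} (hd : 0 < d)
    (c : Fin n → (Fin d → ℝ) → (Fin d → ℝ))
    (hc : ∀ j, IsLittleCube d (c j))
    (hdisj : ∀ j k : Fin n, j ≠ k → interior (Im (c j)) ∩ interior (Im (c k)) = ∅)
    (O : Set (Fin n))
    (hO : ∀ j ∈ O, ∀ t ∈ face1 hd, c j t ∈ face1 hd)
    (c' : Fin m → (Fin d → ℝ) → (Fin d → ℝ))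
    (hc' : ∀ k, IsLittleCube d (c' k))
    (hdisj' : ∀ j k : Fin m, j ≠ k →
      interior (Im (c' j)) ∩ interior (Im (c' k)) = ∅)
    (O' : Set (Fin m))
    (hO' : ∀ k ∈ O', ∀ t ∈ face1 hd, c' k t ∈ face1 hd)
    (i : Fin n) (hi : i ∈ O) :
    ((∀ j k : Fin m, j ≠ k →
        interior (Im (c i ∘ c' j)) ∩ interior (Im (c i ∘ c' k)) = ∅) ∧
      (∀ j : Fin m, ∀ k : Fin n, k ≠ i →
        interior (Im (c i ∘ c' j)) ∩ interior (Im (c k)) = ∅)) ∧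
    (∀ j ∈ O, j ≠ i → ∀ t ∈ face1 hd, c j t ∈ face1 hd) ∧
    (∀ k ∈ O', ∀ t ∈ face1 hd, (c i ∘ c' k) t ∈ face1 hd) := by
  refine ⟨⟨fun j k hjk => ?_, fun j k hk => ?_⟩, fun j hj _ => hO j hj,
    fun k hk t ht => hO i hi _ (hO' k hk t ht)⟩
  · rw [(hc i).interior_Im_comp, (hc i).interior_Im_comp,
      ← Set.image_inter (hc i).injective, hdisj' j k hjk, Set.image_empty]
  · refine Set.subset_eq_empty (Set.inter_subset_inter_left _ ?_) (hdisj i k hk.symm)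
    exact interior_mono ((hc' j).Im_comp_subset (c i))
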